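/- Let f : ℝ → ℝ be bounded on every bounded interval, and let α be a real number. If f(x+1) − f(x) tends to α as x → ∞, then f(x)/x tends to α as x → ∞. -/

import Mathlib

open Filter Topology

/-- If unit increments of `f` beyond `N` are within `ε` of `α`, then increments of length `n`
are within `n * ε` of `n * α`. -/
lemma abs_add_natCast_sub_sub_le {f : ℝ → ℝ} {α ε N : ℝ}
    (h : ∀ x, N ≤ x → |f (x + 1) - f x - α| ≤ ε) {y : ℝ} (hy : N ≤ y) (n : ℕ) :
    |f (y + n) - f y - n * α| ≤ n * ε := by
  induction n with
  | zero => simp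
  | succ n ih =>
    have hstep := h (y + n) (by have : (0 : ℝ) ≤ n := n.cast_nonneg; linarith)
    push_cast
    rw [← add_assoc]
    rw [abs_le] at *
    constructor <;> linarith

/-- Cauchy's theorem from Chapter 2 of the Cours d'Analyse. -/
theorem cauchy_ratio_of_difference (f : ℝ → ℝ) (α : ℝ)
    (hbdd : ∀ a b : ℝ, a < b → ∃ M : ℝ, ∀ x ∈ Set.Icc a b, |f x| ≤ M)
    (h : Tendsto (fun x => f (x + 1) - f x) atTop (𝓝 α)) :
    Tendsto (fun x => f x / x) atTop (𝓝 α) := by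
  rw [Metric.tendsto_atTop] at h ⊢
  intro ε hε
  obtain ⟨N₀, hN₀⟩ := h (ε / 2) (half_pos hε)
  set N := max N₀ 0
  have hN : 0 ≤ N := le_max_right _ _
  have hstep : ∀ x, N ≤ x → |f (x + 1) - f x - α| ≤ ε / 2 := fun x hx =>
    (hN₀ x ((le_max_left _ _).trans hx)).le
  obtain ⟨M, hM⟩ := hbdd N (N + 1) (by linarith)
  set K := M + |α| * (N + 1)
  refine ⟨max (N + 1) (2 * K / ε + 1), fun x hx => ?_⟩
  have hxN : N + 1 ≤ x := (le_max_left _ _).trans hx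
  have hxK : 2 * K / ε < x := by linarith [(le_max_right _ _).trans hx]
  have hx0 : 0 < x := by linarith
  rw [div_lt_iff₀ hε] at hxK
  set n := ⌊x - N⌋₊
  have hn : (n : ℝ) ≤ x - N := Nat.floor_le (by linarith)
  have hn' : x - N < n + 1 := Nat.lt_floor_add_one _
  have hyN : N ≤ x - n := by linarith
  have hyN' : x - n ≤ N + 1 := by linarith
  have hinc := abs_add_natCast_sub_sub_le hstep hyN n
  rw [sub_add_cancel] at hinc
  have hfy := hM (x - n) ⟨hyN, hyN'⟩
  have hαy : |α * (x - n)| ≤ |α| * (N + 1) := by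
    rw [abs_mul, abs_of_nonneg (hN.trans hyN)]
    gcongr
  have hnε : n * (ε / 2) ≤ x * (ε / 2) := by
    gcongr
    linarith
  have hmain : |f x - α * x| < ε * x := by
    rw [abs_le] at hinc hfy hαy
    rw [abs_lt]
    constructor <;> linarith
  rw [Real.dist_eq, show f x / x - α = (f x - α * x) / x by field_simp, abs_div,
    abs_of_pos hx0, div_lt_iff₀ hx0]
  exact hmain
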